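/- For all Boolean normal monotonic (BNM) schemes 𝕏 and 𝕏', SS(𝕏) ⊆ ST(𝕏') and TT(𝕏) ⊆ ST(𝕏'). -/

import Mathlib

namespace ThreeValued

/-- Formulas of the propositional language: countably many variables,
negation, conjunction, disjunction. -/
inductive Fml : Type
  | var : ℕ → Fml
  | neg : Fml → Fml
  | conj : Fml → Fml → Fml
  | disj : Fml → Fml → Fml
deriving DecidableEq

/-- An inference Γ ⇒ φ: a finite set of premises and a conclusion. -/
structure Infer : Type where
  prem : Finset Fml
  concl : Fml

/-- A set of inferences is closed under transitivity:
whenever there is a nonempty Δ with Δ ⇒ φ ∈ L and Γ ⇒ δ ∈ L for all δ ∈ Δ,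
then Γ ⇒ φ ∈ L. -/
def TransClosed (L : Set Infer) : Prop :=
  ∀ (Γ Δ : Finset Fml) (φ : Fml), Δ.Nonempty →
    (⟨Δ, φ⟩ : Infer) ∈ L → (∀ δ ∈ Δ, (⟨Γ, δ⟩ : Infer) ∈ L) → (⟨Γ, φ⟩ : Infer) ∈ L

/-- The transitive closure of a set of inferences: the least superset closed
under transitivity. -/
def T (L : Set Infer) : Set Infer := ⋂₀ {L' : Set Infer | L ⊆ L' ∧ TransClosed L'}

/-- A set of inferences is open under dual transitivity:
whenever there is a nonempty Δ with Δ ⇒ φ ∉ L and Γ ⇒ δ ∉ L for all δ ∈ Δ,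
then Γ ⇒ φ ∉ L. -/
def DualTransClosed (L : Set Infer) : Prop :=
  ∀ (Γ Δ : Finset Fml) (φ : Fml), Δ.Nonempty →
    (⟨Δ, φ⟩ : Infer) ∉ L → (∀ δ ∈ Δ, (⟨Γ, δ⟩ : Infer) ∉ L) → (⟨Γ, φ⟩ : Infer) ∉ L

/-- The dual transitive closure: the greatest subset open under dual
transitivity. -/
def Td (L : Set Infer) : Set Infer := ⋃₀ {L' : Set Infer | L' ⊆ L ∧ DualTransClosed L'}

/-- The three truth values 0, 1/2, 1. -/
inductive V3 : Type
  | zero | half | one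
deriving DecidableEq

/-- A three-valued scheme: a triple of truth functions for ¬, ∧ and ∨. -/
structure Scheme : Type where
  fneg : V3 → V3
  fconj : V3 → V3 → V3
  fdisj : V3 → V3 → V3

/-- Boolean normality: on Boolean inputs the operations agree with the
classical ones. -/
def BooleanNormal (X : Scheme) : Prop :=
  X.fneg .zero = .one ∧ X.fneg .one = .zero ∧
  X.fconj .one .one = .one ∧ X.fconj .one .zero = .zero ∧
  X.fconj .zero .one = .zero ∧ X.fconj .zero .zero = .zero ∧
  X.fdisj .one .one = .one ∧ X.fdisj .one .zero = .one ∧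
  X.fdisj .zero .one = .one ∧ X.fdisj .zero .zero = .zero

/-- The information order: 1/2 is below 0 and below 1. -/
def infLe (a b : V3) : Prop := a = .half ∨ a = b

/-- Monotonicity of a scheme with respect to the information order. -/
def Monotonic (X : Scheme) : Prop :=
  (∀ a b, infLe a b → infLe (X.fneg a) (X.fneg b)) ∧
  (∀ a₁ a₂ b₁ b₂, infLe a₁ b₁ → infLe a₂ b₂ → infLe (X.fconj a₁ a₂) (X.fconj b₁ b₂)) ∧
  (∀ a₁ a₂ b₁ b₂, infLe a₁ b₁ → infLe a₂ b₂ → infLe (X.fdisj a₁ a₂) (X.fdisj b₁ b₂))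

/-- Boolean normal monotonic schemes. -/
def BNM (X : Scheme) : Prop := BooleanNormal X ∧ Monotonic X

/-- Valuations respecting a scheme. -/
def Respects (X : Scheme) (v : Fml → V3) : Prop :=
  (∀ φ, v (.neg φ) = X.fneg (v φ)) ∧
  (∀ φ ψ, v (.conj φ ψ) = X.fconj (v φ) (v ψ)) ∧
  (∀ φ ψ, v (.disj φ ψ) = X.fdisj (v φ) (v ψ))

/-- The strict formula-standard s = {1}. -/
def sStd : Set V3 := {.one}

/-- The tolerant formula-standard t = {1, 1/2}. -/
def tStd : Set V3 := {.one, .half}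

/-- An inference is xy-valid over a scheme X if every valuation respecting X
whose value on each premise is in x gives the conclusion a value in y. -/
def Valid (X : Scheme) (x y : Set V3) (I : Infer) : Prop :=
  ∀ v : Fml → V3, Respects X v → (∀ γ ∈ I.prem, v γ ∈ x) → v I.concl ∈ y

/-- The ss-valid inferences over X. -/
def SS (X : Scheme) : Set Infer := {I | Valid X sStd sStd I}

/-- The tt-valid inferences over X. -/
def TT (X : Scheme) : Set Infer := {I | Valid X tStd tStd I}

/-- The st-valid inferences over X. -/
def ST (X : Scheme) : Set Infer := {I | Valid X sStd tStd I}

/-- The ts-valid inferences over X. -/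
def TS (X : Scheme) : Set Infer := {I | Valid X tStd sStd I}

/-- Classical two-valued valuations. -/
def RespectsCL (v : Fml → Bool) : Prop :=
  (∀ φ, v (.neg φ) = ! v φ) ∧
  (∀ φ ψ, v (.conj φ ψ) = (v φ && v ψ)) ∧
  (∀ φ ψ, v (.disj φ ψ) = (v φ || v ψ))

/-- The classically valid inferences. -/
def CL : Set Infer :=
  {I | ∀ v : Fml → Bool, RespectsCL v → (∀ γ ∈ I.prem, v γ = true) → v I.concl = true}

/-- Substitution: the homomorphic extension of a map from variables to
formulas. -/
def subst (σ : ℕ → Fml) : Fml → Fml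
  | .var n => σ n
  | .neg φ => .neg (subst σ φ)
  | .conj φ ψ => .conj (subst σ φ) (subst σ ψ)
  | .disj φ ψ => .disj (subst σ φ) (subst σ ψ)

/-- Reflexivity. -/
def PropR (L : Set Infer) : Prop := ∀ φ : Fml, (⟨{φ}, φ⟩ : Infer) ∈ L

/-- Monotonicity (weakening). -/
def PropM (L : Set Infer) : Prop :=
  ∀ (Γ Sg : Finset Fml) (φ : Fml), (⟨Γ, φ⟩ : Infer) ∈ L → Γ ⊆ Sg → (⟨Sg, φ⟩ : Infer) ∈ L

/-- Structurality (closure under substitutions). -/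
def PropS (L : Set Infer) : Prop :=
  ∀ (Γ : Finset Fml) (φ : Fml), (⟨Γ, φ⟩ : Infer) ∈ L →
    ∀ σ : ℕ → Fml, (⟨Γ.image (subst σ), subst σ φ⟩ : Infer) ∈ L

/-- The Tarskian closure: the least superset satisfying (R), (M), (T), (S). -/
def Tar (L : Set Infer) : Set Infer :=
  ⋂₀ {L' : Set Infer | L ⊆ L' ∧ PropR L' ∧ PropM L' ∧ TransClosed L' ∧ PropS L'}

/-- L⋆: the inferences whose premise set is an antitheorem of L or whose
conclusion is a theorem of L. -/
def starL (L : Set Infer) : Set Infer :=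
  {I | (∀ ψ : Fml, (⟨I.prem, ψ⟩ : Infer) ∈ L) ∨ (∀ Δ : Finset Fml, (⟨Δ, I.concl⟩ : Infer) ∈ L)}

/-- The propositional variables occurring in a formula. -/
def fvars : Fml → Finset ℕ
  | .var n => {n}
  | .neg φ => fvars φ
  | .conj φ ψ => fvars φ ∪ fvars ψ
  | .disj φ ψ => fvars φ ∪ fvars ψ

/-- The valuation respecting `X` that agrees with `v` on the variables with a
Boolean value and sends all other variables to `0`. -/
def sharpen (X : Scheme) (v : Fml → V3) : Fml → V3
  | .var n => if v (.var n) = .one then .one else .zero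
  | .neg φ => X.fneg (sharpen X v φ)
  | .conj φ ψ => X.fconj (sharpen X v φ) (sharpen X v ψ)
  | .disj φ ψ => X.fdisj (sharpen X v φ) (sharpen X v ψ)

theorem respects_sharpen (X : Scheme) (v : Fml → V3) : Respects X (sharpen X v) :=
  ⟨fun _ => rfl, fun _ _ => rfl, fun _ _ => rfl⟩

theorem BooleanNormal.fneg_eq {X X' : Scheme} (hX : BooleanNormal X) (hX' : BooleanNormal X')
    {a : V3} (ha : a ≠ .half) : X'.fneg a = X.fneg a ∧ X.fneg a ≠ .half := by
  simp only [BooleanNormal] at hX hX'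
  cases a <;> simp_all

theorem BooleanNormal.fconj_eq {X X' : Scheme} (hX : BooleanNormal X) (hX' : BooleanNormal X')
    {a b : V3} (ha : a ≠ .half) (hb : b ≠ .half) :
    X'.fconj a b = X.fconj a b ∧ X.fconj a b ≠ .half := by
  simp only [BooleanNormal] at hX hX'
  cases a <;> cases b <;> simp_all

theorem BooleanNormal.fdisj_eq {X X' : Scheme} (hX : BooleanNormal X) (hX' : BooleanNormal X')
    {a b : V3} (ha : a ≠ .half) (hb : b ≠ .half) :
    X'.fdisj a b = X.fdisj a b ∧ X.fdisj a b ≠ .half := by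
  simp only [BooleanNormal] at hX hX'
  cases a <;> cases b <;> simp_all

/-- Sharpening a valuation of a BNM scheme along any Boolean normal scheme gives a
Boolean valuation above it in the information order. -/
theorem sharpen_ne_half_and_infLe {X X' : Scheme} (hX : BooleanNormal X) (hX' : BNM X')
    {v : Fml → V3} (hv : Respects X' v) (φ : Fml) :
    sharpen X v φ ≠ .half ∧ infLe (v φ) (sharpen X v φ) := by
  obtain ⟨hN, hneg, hconj, hdisj⟩ := hX'
  obtain ⟨vneg, vconj, vdisj⟩ := hv
  induction φ with
  | var n => cases h : v (.var n) <;> simp [sharpen, infLe, h]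
  | neg φ ih =>
    obtain ⟨heq, hne⟩ := hX.fneg_eq hN ih.1
    refine ⟨hne, ?_⟩
    rw [vneg, sharpen, ← heq]
    exact hneg _ _ ih.2
  | conj φ ψ ih₁ ih₂ =>
    obtain ⟨heq, hne⟩ := hX.fconj_eq hN ih₁.1 ih₂.1
    refine ⟨hne, ?_⟩
    rw [vconj, sharpen, ← heq]
    exact hconj _ _ _ _ ih₁.2 ih₂.2
  | disj φ ψ ih₁ ih₂ =>
    obtain ⟨heq, hne⟩ := hX.fdisj_eq hN ih₁.1 ih₂.1
    refine ⟨hne, ?_⟩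
    rw [vdisj, sharpen, ← heq]
    exact hdisj _ _ _ _ ih₁.2 ih₂.2

/-- If designated values lie between `s` and `t`, then validity over a Boolean normal
scheme implies st-validity over every BNM scheme. -/
theorem Valid.st_of_booleanNormal {X X' : Scheme} (hX : BooleanNormal X) (hX' : BNM X')
    {x y : Set V3} (hx : sStd ⊆ x) (hy : y ⊆ tStd) {I : Infer} (h : Valid X x y I) :
    Valid X' sStd tStd I := by
  intro v hv hprem
  have key := sharpen_ne_half_and_infLe hX hX' hv
  have hconcl : sharpen X v I.concl ∈ tStd := by
    refine hy (h _ (respects_sharpen X v) fun γ hγ => hx ?_)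
    have hone : v γ = .one := hprem γ hγ
    simpa [infLe, hone, sStd, eq_comm] using (key γ).2
  rcases (key I.concl).2 with hv' | hv'
  · exact Or.inr hv'
  · exact hv' ▸ hconcl

/-- For BNM schemes, SS and TT are contained in ST (possibly over a different
BNM scheme). -/
theorem stmt5 : ∀ X X' : Scheme, BNM X → BNM X' →
    SS X ⊆ ST X' ∧ TT X ⊆ ST X' := by
  intro X X' hX hX'
  have hst : sStd ⊆ tStd := Set.singleton_subset_iff.2 (Or.inl rfl)
  exact ⟨fun _ h => Valid.st_of_booleanNormal hX.1 hX' subset_rfl hst h,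
    fun _ h => Valid.st_of_booleanNormal hX.1 hX' hst subset_rfl h⟩

end ThreeValued
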